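/- Suppose the cost-difference vectors {Δc_t(·,1)}_{t=1}^T contain at least three linearly independent elements. Then the pooled day-to-day model with parameters (η, θ, ρ, δ(2), ..., δ(M)), where δ(j) = V_1(j) − V_1(1) parameterizes the initial valuations, observed only through daily aggregate route counts O_t(i) = Σ_{n=1}^N 1{X_t^n = i}, is identifiable: equality of the probability of every count sequence under two parameter vectors implies the parameter vectors are equal. -/

import Mathlib

/-!
STATEMENT 11: If the cost-difference vectors {Δc_t(·,1)}_{t=1}^T contain at least three
linearly independent elements, then the pooled day-to-day model with parameters
(η, θ, ρ, δ(2), ..., δ(M)) — initial valuations parameterized by δ(j) = V₁(j) − V₁(1) —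
observed only through the daily aggregate route counts (Multinomial(N, p_t) conditional
on the history), is identifiable: equality of the probability of every count sequence
under two parameter vectors implies the parameter vectors are equal.
(The initial valuations are represented by δ : Fin M → ℝ with δ(1) = 0, i.e. V₁ = δ.)
-/

noncomputable section

/-- Perceived costs with initial values `V1`. -/
def percVal (M : ℕ) (V1 : Fin M → ℝ) (c : ℕ → Fin M → ℝ) (η : ℝ) : ℕ → Fin M → ℝ
  | 0 => V1
  | t + 1 => fun i => (1 - η) * percVal M V1 c η t i + η * c t i

/-- Day-`t` choice probabilities: option 0 (non-travel) with probability ρ,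
path `i` with probability (1-ρ)·exp(-θ V_t(i)) / Σ_m exp(-θ V_t(m)). -/
def choiceProb (M : ℕ) (V1 : Fin M → ℝ) (c : ℕ → Fin M → ℝ) (η θ ρ : ℝ) (t : ℕ) :
    Fin (M + 1) → ℝ :=
  fun k => Fin.cases ρ
    (fun i => (1 - ρ) * Real.exp (-θ * percVal M V1 c η t i) /
      ∑ m : Fin M, Real.exp (-θ * percVal M V1 c η t m)) k

/-- Multinomial probability of count vector `o` for `N` trials with category
probabilities `p`. -/
def multProb (M N : ℕ) (p : Fin (M + 1) → ℝ) (o : Fin (M + 1) → ℕ) : ℝ :=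
  ((Nat.factorial N : ℝ) / ∏ i : Fin (M + 1), (Nat.factorial (o i) : ℝ)) *
    ∏ i : Fin (M + 1), p i ^ o i

/-- Probability of an anonymized (aggregate count) observation sequence. -/
def countSeqProb (M N T : ℕ) (V1 : Fin M → ℝ) (c : ℕ → Fin M → ℝ) (η θ ρ : ℝ)
    (o : Fin T → Fin (M + 1) → ℕ) : ℝ :=
  ∏ t : Fin T, multProb M N (choiceProb M V1 c η θ ρ t) (o t)

/-- If a product of per-coordinate masses agrees at every choice of outcomes, and all masses are
positive and normalized, then the per-coordinate masses agree. -/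
lemma eq_of_forall_prod_eq {ι κ : Type*} [Fintype ι] [DecidableEq ι] [Fintype κ] [Nonempty κ]
    {p q : ι → κ → ℝ} (hp : ∀ t k, 0 < p t k) (hps : ∀ t, ∑ k, p t k = 1)
    (hqs : ∀ t, ∑ k, q t k = 1) (h : ∀ k : ι → κ, ∏ t, p t (k t) = ∏ t, q t (k t)) :
    p = q := by
  obtain ⟨k₀⟩ := ‹Nonempty κ›
  funext t
  have key : ∀ k, p t k * ∏ s ∈ Finset.univ.erase t, p s k₀ =
      q t k * ∏ s ∈ Finset.univ.erase t, q s k₀ := by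
    intro k
    have hk := h (Function.update (fun _ => k₀) t k)
    have split : ∀ f : ι → κ → ℝ, ∏ s, f s (Function.update (fun _ => k₀) t k s) =
        f t k * ∏ s ∈ Finset.univ.erase t, f s k₀ := by
      intro f
      rw [← Finset.mul_prod_erase _ _ (Finset.mem_univ t), Function.update_self]
      congr 1
      refine Finset.prod_congr rfl fun s hs => ?_
      rw [Function.update_of_ne (Finset.ne_of_mem_erase hs)]
    rwa [split p, split q] at hk
  have hrest : ∏ s ∈ Finset.univ.erase t, p s k₀ = ∏ s ∈ Finset.univ.erase t, q s k₀ := by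
    have hsum := Finset.sum_congr (rfl : (Finset.univ : Finset κ) = Finset.univ) fun k _ => key k
    rwa [← Finset.sum_mul, ← Finset.sum_mul, hps, hqs, one_mul, one_mul] at hsum
  have hpos : 0 < ∏ s ∈ Finset.univ.erase t, p s k₀ := Finset.prod_pos fun s _ => hp s k₀
  funext k
  have hk := key k
  rw [← hrest] at hk
  exact mul_right_cancel₀ hpos.ne' hk

lemma choiceProb_pos (M : ℕ) (V1 : Fin M → ℝ) (c : ℕ → Fin M → ℝ) (η θ : ℝ) {ρ : ℝ}
    (hρ : ρ ∈ Set.Ioo (0 : ℝ) 1) (t : ℕ) (k : Fin (M + 1)) :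
    0 < choiceProb M V1 c η θ ρ t k := by
  induction k using Fin.cases with
  | zero => exact hρ.1
  | succ i =>
    have : 0 < 1 - ρ := sub_pos.2 hρ.2
    have hs : 0 < ∑ m : Fin M, Real.exp (-θ * percVal M V1 c η t m) :=
      Finset.sum_pos (fun m _ => Real.exp_pos _) ⟨i, Finset.mem_univ i⟩
    simp only [choiceProb, Fin.cases_succ]
    positivity

lemma sum_choiceProb {M : ℕ} (hM : 0 < M) (V1 : Fin M → ℝ) (c : ℕ → Fin M → ℝ) (η θ ρ : ℝ)
    (t : ℕ) : ∑ k, choiceProb M V1 c η θ ρ t k = 1 := by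
  have hs : 0 < ∑ m : Fin M, Real.exp (-θ * percVal M V1 c η t m) :=
    Finset.sum_pos (fun m _ => Real.exp_pos _) ⟨⟨0, hM⟩, Finset.mem_univ _⟩
  rw [Fin.sum_univ_succ]
  simp only [choiceProb, Fin.cases_zero, Fin.cases_succ]
  rw [← Finset.sum_div, ← Finset.mul_sum, mul_div_cancel_right₀ _ hs.ne']
  ring

/-- The count vector putting all `N` trials on category `k` has probability `p k ^ N`. -/
lemma multProb_single (M N : ℕ) (p : Fin (M + 1) → ℝ) (k : Fin (M + 1)) :
    multProb M N p (Pi.single k N) = p k ^ N := by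
  have hfact : ∏ i, (Nat.factorial ((Pi.single k N : Fin (M + 1) → ℕ) i) : ℝ) =
      Nat.factorial N := by
    rw [Finset.prod_eq_single k (fun i _ hi => by simp [Pi.single_eq_of_ne hi])
      (fun h => absurd (Finset.mem_univ k) h), Pi.single_eq_same]
  have hpow : ∏ i, p i ^ (Pi.single k N : Fin (M + 1) → ℕ) i = p k ^ N := by
    rw [Finset.prod_eq_single k (fun i _ hi => by simp [Pi.single_eq_of_ne hi])
      (fun h => absurd (Finset.mem_univ k) h), Pi.single_eq_same]
  rw [multProb, hfact, hpow, div_self (Nat.cast_ne_zero.2 (Nat.factorial_ne_zero N)), one_mul]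

/-- The law of the counts determines the daily choice probabilities. -/
lemma choiceProb_eq_of_countSeqProb_eq {M N T : ℕ} (hM : 0 < M) (hN : 0 < N)
    {c : ℕ → Fin M → ℝ} {η θ ρ η' θ' ρ' : ℝ} {δ δ' : Fin M → ℝ}
    (hρ : ρ ∈ Set.Ioo (0 : ℝ) 1) (hρ' : ρ' ∈ Set.Ioo (0 : ℝ) 1)
    (h : ∀ o : Fin T → Fin (M + 1) → ℕ, (∀ t, ∑ i : Fin (M + 1), o t i = N) →
      countSeqProb M N T δ c η θ ρ o = countSeqProb M N T δ' c η' θ' ρ' o)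
    {t : ℕ} (ht : t < T) :
    choiceProb M δ c η θ ρ t = choiceProb M δ' c η' θ' ρ' t := by
  have hfun : (fun s : Fin T => choiceProb M δ c η θ ρ s) =
      fun s : Fin T => choiceProb M δ' c η' θ' ρ' s := by
    refine eq_of_forall_prod_eq (fun s k => choiceProb_pos M δ c η θ hρ s k)
      (fun s => sum_choiceProb hM δ c η θ ρ s) (fun s => sum_choiceProb hM δ' c η' θ' ρ' s)
      fun k => ?_
    have hk := h (fun s => Pi.single (k s) N) fun s => by simp
    simp only [countSeqProb, multProb_single, Finset.prod_pow] at hk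
    refine (pow_left_inj₀ ?_ ?_ hN.ne').1 hk
    · exact Finset.prod_nonneg fun s _ => (choiceProb_pos M δ c η θ hρ s _).le
    · exact Finset.prod_nonneg fun s _ => (choiceProb_pos M δ' c η' θ' hρ' s _).le
  exact congrFun hfun ⟨t, ht⟩

/-- The log-odds of two paths is the scaled difference of their perceived costs. -/
lemma log_choiceProb_sub_log_choiceProb (M : ℕ) (V1 : Fin M → ℝ) (c : ℕ → Fin M → ℝ) (η θ : ℝ)
    {ρ : ℝ} (hρ : ρ ∈ Set.Ioo (0 : ℝ) 1) (t : ℕ) (i j : Fin M) :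
    Real.log (choiceProb M V1 c η θ ρ t i.succ) - Real.log (choiceProb M V1 c η θ ρ t j.succ) =
      θ * (percVal M V1 c η t j - percVal M V1 c η t i) := by
  have hρ1 : 1 - ρ ≠ 0 := (sub_pos.2 hρ.2).ne'
  have hs : ∑ m : Fin M, Real.exp (-θ * percVal M V1 c η t m) ≠ 0 :=
    (Finset.sum_pos (fun m _ => Real.exp_pos _) ⟨i, Finset.mem_univ i⟩).ne'
  simp only [choiceProb, Fin.cases_succ]
  rw [Real.log_div (mul_ne_zero hρ1 (Real.exp_ne_zero _)) hs,
    Real.log_div (mul_ne_zero hρ1 (Real.exp_ne_zero _)) hs,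
    Real.log_mul hρ1 (Real.exp_ne_zero _), Real.log_mul hρ1 (Real.exp_ne_zero _),
    Real.log_exp, Real.log_exp]
  ring

/-- A sequence satisfying two exponential-smoothing recursions driven by the same input, two terms
of which are linearly independent, has uniquely determined smoothing coefficients. -/
lemma smoothing_coeff_unique {E : Type*} [AddCommGroup E] [Module ℝ E] {T : ℕ} {x d : ℕ → E}
    {a b a' b' : ℝ} (hb : b ≠ 0)
    (h : ∀ t, t + 1 < T → x (t + 1) = a • x t + b • d t)
    (h' : ∀ t, t + 1 < T → x (t + 1) = a' • x t + b' • d t)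
    {s u : ℕ} (hsu : s < u) (hu : u + 1 < T) (hli : LinearIndependent ℝ ![d s, d u]) :
    a = a' ∧ b = b' := by
  have hs0 : d s ≠ 0 := hli.ne_zero 0
  have hrel : ∀ t, t + 1 < T → (a - a') • x t = (b' - b) • d t := by
    intro t ht
    have e := (h t ht).symm.trans (h' t ht)
    rw [← sub_eq_zero] at e ⊢
    rw [← e]
    module
  have ha : a = a' := by
    by_contra hne
    have hne' : a - a' ≠ 0 := sub_ne_zero.2 hne
    set k := (a - a')⁻¹ * (b' - b) with hk
    have hx : ∀ t, t + 1 < T → x t = k • d t := by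
      intro t ht
      rw [hk, mul_smul, ← hrel t ht, smul_smul, inv_mul_cancel₀ hne', one_smul]
    have hd : ∀ t, t + 2 < T → k • d (t + 1) = (a * k + b) • d t := by
      intro t ht
      rw [← hx (t + 1) ht, h t (by omega), hx t (by omega)]
      module
    by_cases hk0 : k = 0
    · have := hd s (by omega)
      rw [hk0] at this
      simp only [zero_smul, mul_zero, zero_add] at this
      exact hs0 ((smul_eq_zero.1 this.symm).resolve_left hb)
    · set r := k⁻¹ * (a * k + b) with hr
      have hpow : ∀ n, s + n + 1 < T → d (s + n) = r ^ n • d s := by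
        intro n
        induction n with
        | zero => simp
        | succ n ih =>
          intro hn
          have hstep := hd (s + n) (by omega)
          rw [← add_assoc, pow_succ', mul_smul, ← ih (by omega), hr, mul_smul, ← hstep,
            smul_smul, inv_mul_cancel₀ hk0, one_smul]
      have hdu := hpow (u - s) (by omega)
      rw [Nat.add_sub_cancel' hsu.le] at hdu
      have := LinearIndependent.pair_iff.1 hli (r ^ (u - s)) (-1) (by rw [hdu]; module)
      norm_num at this
  refine ⟨ha, ?_⟩
  have hrs := hrel s (by omega)
  rw [ha, sub_self, zero_smul] at hrs
  exact (sub_eq_zero.1 ((smul_eq_zero.1 hrs.symm).resolve_right hs0)).symm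

/-- Among three times below `T` with linearly independent vectors, two precede the last one. -/
lemma exists_pair_before_last {E : Type*} [AddCommGroup E] [Module ℝ E] {T : ℕ} {d : ℕ → E}
    {t₁ t₂ t₃ : ℕ} (h₁ : t₁ < T) (h₂ : t₂ < T) (h₃ : t₃ < T)
    (hli : LinearIndependent ℝ ![d t₁, d t₂, d t₃]) :
    ∃ s u, s < u ∧ u + 1 < T ∧ LinearIndependent ℝ ![d s, d u] := by
  have hd : ∀ i : Fin 3, ![d t₁, d t₂, d t₃] i = d (![t₁, t₂, t₃] i) := by
    intro i
    fin_cases i <;> rfl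
  have hpair : ∀ i j : Fin 3, i ≠ j →
      LinearIndependent ℝ ![d (![t₁, t₂, t₃] i), d (![t₁, t₂, t₃] j)] := by
    intro i j hij
    have := hli.comp ![i, j] (by
      intro x y hxy
      fin_cases x <;> fin_cases y <;> simp_all [eq_comm])
    convert this using 1
    ext x
    fin_cases x <;> simp [hd]
  have hne : ∀ i j : Fin 3, i ≠ j → ![t₁, t₂, t₃] i ≠ ![t₁, t₂, t₃] j := by
    intro i j hij heq
    have := (hpair i j hij).injective.ne (show (0 : Fin 2) ≠ 1 by decide)
    simp [heq] at this
  have hlt : ∀ i j : Fin 3, i ≠ j → ![t₁, t₂, t₃] i + 1 < T → ![t₁, t₂, t₃] j + 1 < T →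
      ∃ s u, s < u ∧ u + 1 < T ∧ LinearIndependent ℝ ![d s, d u] := by
    intro i j hij hi hj
    rcases lt_trichotomy (![t₁, t₂, t₃] i) (![t₁, t₂, t₃] j) with hlt | heq | hgt
    · exact ⟨_, _, hlt, hj, hpair i j hij⟩
    · exact absurd heq (hne i j hij)
    · exact ⟨_, _, hgt, hi, hpair j i hij.symm⟩
  have h12 : t₁ ≠ t₂ := hne 0 1 (by decide)
  have h13 : t₁ ≠ t₃ := hne 0 2 (by decide)
  have h23 : t₂ ≠ t₃ := hne 1 2 (by decide)
  by_cases hl₁ : t₁ + 1 < T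
  · by_cases hl₂ : t₂ + 1 < T
    · exact hlt 0 1 (by decide) hl₁ hl₂
    · exact hlt 0 2 (by decide) hl₁ (show t₃ + 1 < T by omega)
  · exact hlt 1 2 (by decide) (show t₂ + 1 < T by omega) (show t₃ + 1 < T by omega)

theorem anonymized_endogenized_identifiable
    (M N T : ℕ) (hM : 0 < M) (hN : 0 < N) (hT : 0 < T)
    (c : ℕ → Fin M → ℝ) (C : ℝ) (hc : ∀ t i, |c t i| ≤ C)
    -- stronger dynamic richness: three linearly independent cost-difference vectors
    (hrich : ∃ t1 t2 t3 : ℕ, t1 < T ∧ t2 < T ∧ t3 < T ∧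
      LinearIndependent ℝ
        ![(fun j : Fin M => c t1 j - c t1 ⟨0, hM⟩),
          (fun j : Fin M => c t2 j - c t2 ⟨0, hM⟩),
          (fun j : Fin M => c t3 j - c t3 ⟨0, hM⟩)]) :
    ∀ (η θ ρ η' θ' ρ' : ℝ) (δ δ' : Fin M → ℝ),
      η ∈ Set.Ioo (0 : ℝ) 1 → 0 < θ → ρ ∈ Set.Ioo (0 : ℝ) 1 →
      η' ∈ Set.Ioo (0 : ℝ) 1 → 0 < θ' → ρ' ∈ Set.Ioo (0 : ℝ) 1 →
      δ ⟨0, hM⟩ = 0 → δ' ⟨0, hM⟩ = 0 →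
      (∀ o : Fin T → Fin (M + 1) → ℕ, (∀ t, ∑ i : Fin (M + 1), o t i = N) →
        countSeqProb M N T δ c η θ ρ o = countSeqProb M N T δ' c η' θ' ρ' o) →
      η = η' ∧ θ = θ' ∧ ρ = ρ' ∧ δ = δ' := by
  intro η θ ρ η' θ' ρ' δ δ' hη hθ hρ hη' hθ' hρ' hδ hδ' h
  obtain ⟨t₁, t₂, t₃, h₁, h₂, h₃, hli⟩ := hrich
  have hp : ∀ t, t < T → choiceProb M δ c η θ ρ t = choiceProb M δ' c η' θ' ρ' t :=
    fun t ht => choiceProb_eq_of_countSeqProb_eq hM hN hρ hρ' h ht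
  let d : ℕ → Fin M → ℝ := fun t j => c t j - c t ⟨0, hM⟩
  let x : ℕ → Fin M → ℝ := fun t j =>
    θ * (percVal M δ c η t j - percVal M δ c η t ⟨0, hM⟩)
  have hx' : ∀ t, t < T → ∀ j,
      x t j = θ' * (percVal M δ' c η' t j - percVal M δ' c η' t ⟨0, hM⟩) := by
    intro t ht j
    rw [← log_choiceProb_sub_log_choiceProb M δ' c η' θ' hρ', ← hp t ht,
      log_choiceProb_sub_log_choiceProb M δ c η θ hρ]
  obtain ⟨s, u, hsu, hu, hpair⟩ := exists_pair_before_last (d := d) h₁ h₂ h₃ hli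
  obtain ⟨ha, hb⟩ := smoothing_coeff_unique (T := T) (x := x) (d := d)
    (a := 1 - η) (b := η * θ) (a' := 1 - η') (b' := η' * θ') (mul_pos hη.1 hθ).ne'
    (fun t _ => by
      funext j
      simp only [x, d, percVal, Pi.add_apply, Pi.smul_apply, smul_eq_mul]
      ring)
    (fun t ht => by
      funext j
      simp only [Pi.add_apply, Pi.smul_apply, smul_eq_mul]
      rw [hx' (t + 1) ht, hx' t (by omega)]
      simp only [d, percVal]
      ring)
    hsu hu hpair
  have hηη : η = η' := by linarith
  subst hηη
  have hθθ : θ = θ' := mul_left_cancel₀ hη.1.ne' hb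
  subst hθθ
  refine ⟨rfl, rfl, congrFun (hp 0 hT) 0, ?_⟩
  funext j
  have hj := mul_left_cancel₀ hθ.ne' (hx' 0 hT j)
  simpa only [percVal, hδ, hδ', sub_zero] using hj
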